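/- Let m ≥ 3 be an integer and let P ∈ ℂ[x,y] be a homogeneous polynomial of degree m satisfying equation (E) with parameters (a, b) = (1, 0), and such that P(λ, λ) = 0 for all λ ∈ ℂ. Then P = 0. -/

import Mathlib

open MvPolynomial

/-- Evaluation of a bivariate polynomial at a pair of complex numbers. -/
noncomputable def ev2 (P : MvPolynomial (Fin 2) ℂ) (x y : ℂ) : ℂ :=
  MvPolynomial.eval ![x, y] P

/-- Homogeneity of degree `n` of the evaluation map of a homogeneous polynomial. -/
lemma MvPolynomial.IsHomogeneous.eval_smul_vec {R σ : Type*} [CommSemiring R]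
    {φ : MvPolynomial σ R} {n : ℕ} (h : φ.IsHomogeneous n) (r : R) (v : σ → R) :
    MvPolynomial.eval (r • v) φ = r ^ n * MvPolynomial.eval v φ := by
  rw [MvPolynomial.eval_eq, MvPolynomial.eval_eq, Finset.mul_sum]
  refine Finset.sum_congr rfl fun d hd => ?_
  have hdeg : ∑ i ∈ d.support, d i = n := by
    rw [← h (MvPolynomial.mem_support_iff.mp hd), Finsupp.weight_apply, Finsupp.sum]
    simp
  simp only [Pi.smul_apply, smul_eq_mul, mul_pow, Finset.prod_mul_distrib,
    Finset.prod_pow_eq_pow_sum, hdeg]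
  ring

lemma ev2_zero_left {P : MvPolynomial (Fin 2) ℂ} {n : ℕ} (h : P.IsHomogeneous n) (z : ℂ) :
    ev2 P 0 z = z ^ n * ev2 P 0 1 := by
  simpa [ev2] using h.eval_smul_vec z ![0, 1]

/-- The Euler identity for bivariate homogeneous polynomials, evaluated at a point. -/
lemma ev2_euler {P : MvPolynomial (Fin 2) ℂ} {n : ℕ} (h : P.IsHomogeneous n) (x y : ℂ) :
    x * ev2 (pderiv 0 P) x y + y * ev2 (pderiv 1 P) x y = n * ev2 P x y := by
  simpa [ev2] using congrArg (MvPolynomial.eval ![x, y]) h.sum_X_mul_pderiv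

/-- The chain rule for a bivariate polynomial along a differentiable curve. -/
lemma HasDerivAt.ev2_comp {f g : ℂ → ℂ} {f' g' t : ℂ} (hf : HasDerivAt f f' t)
    (hg : HasDerivAt g g' t) (P : MvPolynomial (Fin 2) ℂ) :
    HasDerivAt (fun s => ev2 P (f s) (g s))
      (f' * ev2 (pderiv 0 P) (f t) (g t) + g' * ev2 (pderiv 1 P) (f t) (g t)) t := by
  unfold ev2
  induction P using MvPolynomial.induction_on with
  | C a => simpa using hasDerivAt_const t a
  | add p q hp hq =>
    simp only [map_add]
    exact (hp.add hq).congr_deriv (by ring)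
  | mul_X p i hp =>
    fin_cases i
    · simp only [map_mul, Derivation.leibniz, map_add]
      refine ((hp.mul hf).congr_deriv ?_).congr_of_eventuallyEq (.of_forall fun s => ?_)
      · simp [pderiv_X]
        ring
      · simp
    · simp only [map_mul, Derivation.leibniz, map_add]
      refine ((hp.mul hg).congr_deriv ?_).congr_of_eventuallyEq (.of_forall fun s => ?_)
      · simp [pderiv_X]
        ring
      · simp

theorem stmt8 (m : ℕ) (hm : 3 ≤ m)
    (P : MvPolynomial (Fin 2) ℂ) (hhom : P.IsHomogeneous m)
    (hE : ∀ l1 l2 l3 : ℂ,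
      (((0 : ℂ) - 1) * l1 - l2 - l3) * ev2 P l2 l3
        - (-l1 + ((0 : ℂ) - 1) * l2 - l3) * ev2 P l1 l3
        - (l1 - l2) * ev2 P (l1 + l2) l3
        - (((1 : ℂ) - 1) * l1 - l3) * ev2 P l2 (l1 + l3)
        + (((1 : ℂ) - 1) * l2 - l3) * ev2 P l1 (l2 + l3) = 0)
    (hPd : ∀ lam : ℂ, ev2 P lam lam = 0) :
    P = 0 := by
  -- Differentiate the cocycle equation in the first variable at `0` and apply the Euler identity.
  have key (y z : ℂ) : ((m : ℂ) - 2) * ev2 P y z + ev2 P 0 z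
      + (y + z) * ev2 (pderiv 0 P) 0 z - z * ev2 (pderiv 0 P) 0 (y + z) = 0 := by
    have hid := hasDerivAt_id' (0 : ℂ)
    have hc (c : ℂ) := hasDerivAt_const (0 : ℂ) c
    have hs : HasDerivAt (fun t : ℂ => t + y + z) 1 0 := (hid.add_const y).add_const z
    have hd := ((((hs.mul (hid.ev2_comp (hc z) P)).sub (hs.mul (hc (ev2 P y z)))).sub
      ((hid.sub_const y).mul ((hid.add_const y).ev2_comp (hc z) P))).add
      (((hc y).ev2_comp (hid.add_const z) P).const_mul z)).sub
      ((hid.ev2_comp (hc (y + z)) P).const_mul z)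
    have h0 := hd.unique ((hc 0).congr_of_eventuallyEq (.of_forall fun t => by
      simp only [Pi.add_apply, Pi.sub_apply, Pi.mul_apply]
      linear_combination hE t y z))
    simp only [zero_add] at h0
    linear_combination h0 - ev2_euler hhom y z
  have hP0 (z : ℂ) : ev2 P 0 z = 0 := by
    have hm1 : (m : ℂ) - 1 ≠ 0 := sub_ne_zero.mpr (by norm_cast; omega)
    have h := key 0 z
    rw [zero_add] at h
    exact (mul_eq_zero.mp (by linear_combination h :
      ((m : ℂ) - 1) * ev2 P 0 z = 0)).resolve_left hm1
  have hd := ev2_zero_left hhom.pderiv (P := pderiv 0 P)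
  have hd1 : ev2 (pderiv 0 P) 0 1 = 0 := by
    have hpow : (2 : ℂ) - 2 ^ (m - 1) ≠ 0 := by
      have : 2 ^ 1 < 2 ^ (m - 1) := Nat.pow_lt_pow_right one_lt_two (by omega)
      exact sub_ne_zero.mpr (by norm_cast; omega)
    have h := key 1 1
    rw [hPd, hP0, hd (1 + 1), one_add_one_eq_two] at h
    exact (mul_eq_zero.mp (by linear_combination h :
      ((2 : ℂ) - 2 ^ (m - 1)) * ev2 (pderiv 0 P) 0 1 = 0)).resolve_left hpow
  have hm2 : (m : ℂ) - 2 ≠ 0 := sub_ne_zero.mpr (by norm_cast; omega)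
  refine MvPolynomial.funext fun v => ?_
  have h := key (v 0) (v 1)
  rw [hP0, hd (v 1), hd (v 0 + v 1), hd1] at h
  have hv : ev2 P (v 0) (v 1) = 0 :=
    (mul_eq_zero.mp (by linear_combination h)).resolve_left hm2
  have hvec : ![v 0, v 1] = v := by
    ext i
    fin_cases i <;> rfl
  rw [ev2, hvec] at hv
  rw [hv, map_zero]
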